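/- Lemma on lower and upper solutions: Let G ⊆ ℝ² be open, f : ℝ² → ℝ continuous on G, (x₀,y₀) ∈ G, and a,b > 0 with R = [x₀−a, x₀+a] × [y₀−b, y₀+b] ⊆ G; set M = sup_R |f|, h = a if M = 0 and h = min{a, b/M} otherwise. Then there exist solutions χˡ and χᵘ of the initial value problem IVP(x₀,y₀) of y' = f(x,y), defined on the Peano segment [x₀−h, x₀+h] with graphs in G, such that every solution χ of IVP(x₀,y₀) defined on [x₀−h, x₀+h] with graph in G satisfies χˡ(x) ≤ χ(x) ≤ χᵘ(x) for all x ∈ [x₀−h, x₀+h]. -/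

import Mathlib

open Set

/-- `φ` is a solution of `y' = f(x,y)` on the set `I ⊆ ℝ` with graph in `S`:
it is differentiable at every point of `I` (one-sided at endpoints, expressed via
`HasDerivWithinAt`), its graph lies in `S`, and it satisfies the equation. -/
def IsSolOn (f : ℝ × ℝ → ℝ) (S : Set (ℝ × ℝ)) (φ : ℝ → ℝ) (I : Set ℝ) : Prop :=
  ∀ x ∈ I, (x, φ x) ∈ S ∧ HasDerivWithinAt φ (f (x, φ x)) I x

open Filter Topology NNReal

/-- Comparison of solutions of two scalar equations with strictly ordered right-hand sides. -/
lemma le_of_hasDerivWithinAt_of_lt {g p : ℝ × ℝ → ℝ} {v w : ℝ → ℝ} {α β : ℝ}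
    (hlt : ∀ q, g q < p q) (h0 : v α ≤ w α)
    (hv : ∀ x ∈ Icc α β, HasDerivWithinAt v (g (x, v x)) (Icc α β) x)
    (hw : ∀ x ∈ Icc α β, HasDerivWithinAt w (p (x, w x)) (Icc α β) x) :
    ∀ x ∈ Icc α β, v x ≤ w x := by
  have hIci {k k' : ℝ → ℝ} (hk : ∀ x ∈ Icc α β, HasDerivWithinAt k (k' x) (Icc α β) x) :
      ∀ x ∈ Ico α β, HasDerivWithinAt k (k' x) (Ici x) x := fun x hx =>
    (hk x (Ico_subset_Icc_self hx)).mono_of_mem_nhdsWithin (Icc_mem_nhdsGE_of_mem hx)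
  refine image_le_of_deriv_right_lt_deriv_boundary' (HasDerivWithinAt.continuousOn hv)
    (hIci hv) h0 (HasDerivWithinAt.continuousOn hw) (hIci hw) fun x _ hx => ?_
  rw [hx]
  exact hlt _

/-- A bounded continuous scalar equation has a solution after a strictly positive, arbitrarily
small perturbation of its right-hand side. -/
lemma exists_hasDerivWithinAt_perturbation {g : ℝ × ℝ → ℝ} (hg : Continuous g) {M : ℝ}
    (hM : ∀ q, |g q| ≤ M) {α β : ℝ} (hαβ : α ≤ β) (y₀ : ℝ) {d : ℝ} (hd : 0 < d) :
    ∃ (p : ℝ × ℝ → ℝ) (w : ℝ → ℝ), Continuous p ∧ (∀ q, g q + 2 * d < p q ∧ p q < g q + 4 * d) ∧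
      w α = y₀ ∧ ∀ x ∈ Icc α β, HasDerivWithinAt w (p (x, w x)) (Icc α β) x := by
  obtain ⟨p, hp, hpg, -⟩ := (hg.add_const (3 * d)).exists_contDiff_approx 1
    (ε := fun _ => d) continuous_const fun _ => hd
  have hbd q : g q + 2 * d < p q ∧ p q < g q + 4 * d := by
    have := abs_lt.1 (Real.dist_eq _ _ ▸ hpg q)
    constructor <;> linarith
  have hM0 : 0 ≤ M := (abs_nonneg _).trans (hM 0)
  let L : ℝ≥0 := ⟨M + 4 * d, by positivity⟩
  let A : ℝ≥0 := L * ⟨β - α, sub_nonneg.2 hαβ⟩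
  obtain ⟨K, hK⟩ := hp.contDiffOn.exists_lipschitzOnWith (s := Icc α β ×ˢ Metric.closedBall y₀ A)
    one_ne_zero ((convex_Icc _ _).prod (convex_closedBall _ _))
    (isCompact_Icc.prod (isCompact_closedBall _ _))
  have hPL : IsPicardLindelof (fun t y => p (t, y)) (⟨α, left_mem_Icc.2 hαβ⟩ : Icc α β)
      y₀ A 0 L K := by
    refine ⟨fun t ht => ?_, fun x _ => ?_, fun t _ x _ => ?_, ?_⟩
    · have := hK.comp ((LipschitzWith.prodMk_left t).lipschitzOnWith
        (s := Metric.closedBall y₀ (A : ℝ))) fun y hy => ⟨ht, hy⟩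
      simpa only [mul_one] using! this
    · exact (hp.continuous.comp (by fun_prop)).continuousOn
    · have h1 := hbd (t, x)
      have h2 := abs_le.1 (hM (t, x))
      change |p (t, x)| ≤ M + 4 * d
      exact abs_le.2 ⟨by linarith, by linarith⟩
    · simp only [sub_self, max_eq_left (sub_nonneg.2 hαβ), NNReal.coe_zero, sub_zero]
      exact le_rfl
  obtain ⟨w, hw0, hw⟩ := hPL.exists_eq_forall_mem_Icc_hasDerivWithinAt₀
  exact ⟨p, w, hp.continuous, hbd, hw0, hw⟩

/-- A scalar equation with bounded continuous right-hand side has a maximal solution to the right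
of the initial point. -/
lemma exists_maximal_hasDerivWithinAt {g : ℝ × ℝ → ℝ} (hg : Continuous g) {M : ℝ}
    (hM : ∀ q, |g q| ≤ M) {α β : ℝ} (hαβ : α ≤ β) (y₀ : ℝ) :
    ∃ u : ℝ → ℝ, u α = y₀ ∧ (∀ x ∈ Icc α β, HasDerivWithinAt u (g (x, u x)) (Icc α β) x) ∧
      ∀ v : ℝ → ℝ, v α = y₀ → (∀ x ∈ Icc α β, HasDerivWithinAt v (g (x, v x)) (Icc α β) x) →
        ∀ x ∈ Icc α β, v x ≤ u x := by
  let d : ℕ → ℝ := fun n => (1 / 4) ^ n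
  have hd n : 0 < d n := by positivity
  have hd1 n : d n ≤ 1 := pow_le_one₀ (by norm_num) (by norm_num)
  have hd_succ n : 4 * d (n + 1) = d n := by simp only [d, pow_succ]; ring
  have hd_lim : Tendsto d atTop (𝓝 0) :=
    tendsto_pow_atTop_nhds_zero_of_lt_one (by norm_num) (by norm_num)
  choose p w hp hpg hw0 hw using fun n =>
    exists_hasDerivWithinAt_perturbation hg hM hαβ y₀ (hd n)
  have hp_le n q : |p n q| ≤ M + 4 := by
    have h1 := hpg n q
    have h2 := abs_le.1 (hM q)
    have h3 := hd1 n
    have h4 := hd n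
    exact abs_le.2 ⟨by linarith, by linarith⟩
  have hanti {x} (hx : x ∈ Icc α β) : Antitone fun n => w n x := antitone_nat_of_succ_le fun n =>
    le_of_hasDerivWithinAt_of_lt (fun q => by linarith [hpg n q, hpg (n + 1) q, hd_succ n, hd n])
      (by rw [hw0, hw0]) (hw (n + 1)) (hw n) x hx
  have hlip n {s t} (hs : s ∈ Icc α β) (ht : t ∈ Icc α β) :
      |w n t - w n s| ≤ (M + 4) * |t - s| :=
    (convex_Icc α β).norm_image_sub_le_of_norm_hasDerivWithin_le (hw n)
      (fun x _ => hp_le n _) hs ht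
  have hα : α ∈ Icc α β := left_mem_Icc.2 hαβ
  let u : ℝ → ℝ := fun x => ⨅ n, w n x
  have hlim {x} (hx : x ∈ Icc α β) : Tendsto (fun n => w n x) atTop (𝓝 (u x)) := by
    refine tendsto_atTop_ciInf (hanti hx) ⟨y₀ - (M + 4) * |x - α|, ?_⟩
    rintro _ ⟨n, rfl⟩
    have := abs_le.1 (hlip n hα hx)
    rw [hw0] at this
    change _ ≤ w n x
    linarith
  have hu_lip : LipschitzOnWith (Real.toNNReal (M + 4)) u (Icc α β) := by
    refine LipschitzOnWith.of_dist_le_mul fun t ht s hs => ?_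
    rw [Real.coe_toNNReal _ ((abs_nonneg _).trans (hp_le 0 0)), Real.dist_eq, Real.dist_eq]
    exact le_of_tendsto ((hlim ht).sub (hlim hs)).abs (Eventually.of_forall fun n => hlip n hs ht)
  have hpicard {t} (ht : t ∈ Icc α β) : u t = ODE.picard (fun s y => g (s, y)) α y₀ u t := by
    have hsub : uIcc α t ⊆ Icc α β := uIcc_subset_Icc hα ht
    have h1 n : w n t = y₀ + ∫ s in α..t, p n (s, w n s) := by
      have := ODE.picard_eq_of_hasDerivAt (f := fun s y => p n (s, y)) (u := univ) (t₀ := α)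
        (α := w n) (t := t) (hp n).continuousOn
        (fun s hs => (hw n s (hsub hs)).mono hsub) (mapsTo_univ _ _)
      rw [← this, ODE.picard_apply, hw0]
    refine tendsto_nhds_unique (hlim ht) ?_
    simp_rw [h1, ODE.picard_apply]
    refine tendsto_const_nhds.add
      (intervalIntegral.tendsto_integral_filter_of_dominated_convergence (fun _ => M + 4)
        (Eventually.of_forall fun n => ?_)
        (Eventually.of_forall fun n => Eventually.of_forall fun s _ => hp_le n _)
        intervalIntegrable_const (Eventually.of_forall fun s hs => ?_))
    · have : ContinuousOn (fun s => p n (s, w n s)) (uIcc α t) :=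
        (hp n).comp_continuousOn (continuousOn_id.prodMk
          ((HasDerivWithinAt.continuousOn (hw n)).mono hsub))
      exact (this.mono uIoc_subset_uIcc).aestronglyMeasurable measurableSet_uIoc
    · have hs' : s ∈ Icc α β := hsub (uIoc_subset_uIcc hs)
      have hgs : Tendsto (fun n => g (s, w n s)) atTop (𝓝 (g (s, u s))) :=
        (hg.tendsto _).comp (tendsto_const_nhds.prodMk_nhds (hlim hs'))
      have h2 (c : ℝ) : Tendsto (fun n => g (s, w n s) + c * d n) atTop (𝓝 (g (s, u s))) := by
        simpa using hgs.add (hd_lim.const_mul c)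
      exact tendsto_of_tendsto_of_tendsto_of_le_of_le (h2 2) (h2 4)
        (fun n => (hpg n _).1.le) (fun n => (hpg n _).2.le)
  refine ⟨u, ?_, fun x hx => ?_, fun v hv0 hv x hx => ?_⟩
  · simp [u, hw0]
  · exact (ODE.hasDerivWithinAt_picard_Icc (f := fun s y => g (s, y)) (u := univ) hα
      hg.continuousOn hu_lip.continuousOn (fun _ _ => mem_univ _) y₀ hx).congr
        (fun t ht => hpicard ht) (hpicard hx)
  · exact ge_of_tendsto (hlim hx) (Eventually.of_forall fun n =>
      le_of_hasDerivWithinAt_of_lt (fun q => by linarith [hpg n q, hd n])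
        (by rw [hv0, hw0]) hv (hw n) x hx)

/-- A solution starting at the centre of a box in which the slopes are small enough stays in
that box. -/
lemma abs_sub_le_of_isSolOn {f : ℝ × ℝ → ℝ} {x₀ y₀ h b M : ℝ}
    (hM0 : 0 ≤ M) (hb : 0 < b) (hMh : M * h ≤ b)
    (hM : ∀ q ∈ Icc x₀ (x₀ + h) ×ˢ Icc (y₀ - b) (y₀ + b), |f q| ≤ M)
    {v : ℝ → ℝ} (hv0 : v x₀ = y₀) (hv : IsSolOn f univ v (Icc x₀ (x₀ + h))) :
    ∀ x ∈ Icc x₀ (x₀ + h), |v x - y₀| ≤ b := by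
  intro z hz
  have hcont : ContinuousOn v (Icc x₀ (x₀ + h)) :=
    HasDerivWithinAt.continuousOn fun x hx => (hv x hx).2
  have key : ∀ z ∈ Ico x₀ (x₀ + h), |v z - y₀| ≤ b := by
    intro z hz
    have hMz : M * (z - x₀) < b := by
      rcases hM0.eq_or_lt with rfl | hpos
      · simpa using hb
      · nlinarith [hz.2]
    obtain ⟨ε, hε, hεb⟩ : ∃ ε > 0, (M + ε) * (z - x₀) ≤ b := by
      have hz1 : 0 < z - x₀ + 1 := by linarith [hz.1]
      refine ⟨(b - M * (z - x₀)) / (z - x₀ + 1), div_pos (by linarith) hz1, ?_⟩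
      have h1 : (b - M * (z - x₀)) / (z - x₀ + 1) * (z - x₀ + 1) = b - M * (z - x₀) :=
        div_mul_cancel₀ _ hz1.ne'
      have h2 := div_pos (sub_pos.2 hMz) hz1
      linarith
    have hsub : Icc x₀ z ⊆ Icc x₀ (x₀ + h) := Icc_subset_Icc_right hz.2.le
    have hfence := image_norm_le_of_norm_deriv_right_lt_deriv_boundary
      (f := fun x => v x - y₀) (f' := fun x => f (x, v x)) (a := x₀) (b := z)
      (B := fun x => (M + ε) * (x - x₀)) (B' := fun _ => M + ε)
      ((hcont.mono hsub).sub continuousOn_const)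
      (fun x hx => ((hv x (hsub (Ico_subset_Icc_self hx))).2.sub_const y₀).mono_of_mem_nhdsWithin
        (Icc_mem_nhdsGE_of_mem ⟨hx.1, hx.2.trans hz.2⟩))
      (by simp [hv0])
      (fun x => by simpa using ((hasDerivAt_id x).sub_const x₀).const_mul (M + ε))
      (fun x hx hxe => by
        have hxb : |v x - y₀| ≤ b := by
          rw [← Real.norm_eq_abs, hxe]
          nlinarith [hx.2]
        have h3 := abs_le.1 hxb
        have := hM (x, v x) ⟨hsub (Ico_subset_Icc_self hx), by constructor <;> linarith⟩
        rw [Real.norm_eq_abs]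
        linarith)
    exact (hfence (right_mem_Icc.2 hz.1)).trans hεb
  rcases hz.1.eq_or_lt with rfl | hlt
  · simpa [hv0] using hb.le
  have hlt' : x₀ < x₀ + h := hlt.trans_le hz.2
  have hclosure : closure (Ico x₀ (x₀ + h)) = Icc x₀ (x₀ + h) := closure_Ico hlt'.ne
  have hbd := ContinuousWithinAt.closure_le (s := Ico x₀ (x₀ + h)) (f := fun x => |v x - y₀|)
    (g := fun _ => b) (x := z) (hclosure ▸ hz)
    (((hcont.sub continuousOn_const).abs z hz).mono Ico_subset_Icc_self)
    continuousWithinAt_const key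
  exact hbd

/-- Existence of the upper solution to the right of the initial point. -/
lemma exists_upper_solution_right {f : ℝ × ℝ → ℝ} {x₀ y₀ h b M : ℝ}
    (hM0 : 0 ≤ M) (hb : 0 < b) (hh : 0 ≤ h) (hMh : M * h ≤ b)
    (hf : ContinuousOn f (Icc x₀ (x₀ + h) ×ˢ Icc (y₀ - b) (y₀ + b)))
    (hM : ∀ q ∈ Icc x₀ (x₀ + h) ×ˢ Icc (y₀ - b) (y₀ + b), |f q| ≤ M) :
    ∃ u : ℝ → ℝ, u x₀ = y₀ ∧
      IsSolOn f (Icc x₀ (x₀ + h) ×ˢ Icc (y₀ - b) (y₀ + b)) u (Icc x₀ (x₀ + h)) ∧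
      ∀ v : ℝ → ℝ, v x₀ = y₀ → IsSolOn f univ v (Icc x₀ (x₀ + h)) →
        ∀ x ∈ Icc x₀ (x₀ + h), v x ≤ u x := by
  have hx : x₀ ≤ x₀ + h := by linarith
  have hy : y₀ - b ≤ y₀ + b := by linarith
  let π : ℝ × ℝ → ℝ × ℝ := fun q => (projIcc _ _ hx q.1, projIcc _ _ hy q.2)
  have hπ q : π q ∈ Icc x₀ (x₀ + h) ×ˢ Icc (y₀ - b) (y₀ + b) :=
    ⟨(projIcc _ _ hx q.1).2, (projIcc _ _ hy q.2).2⟩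
  have hπc : Continuous π :=
    (continuous_subtype_val.comp (continuous_projIcc.comp continuous_fst)).prodMk
      (continuous_subtype_val.comp (continuous_projIcc.comp continuous_snd))
  have hπ_eq {q} (hq : q ∈ Icc x₀ (x₀ + h) ×ˢ Icc (y₀ - b) (y₀ + b)) : π q = q := by
    simp [π, projIcc_of_mem _ hq.1, projIcc_of_mem _ hq.2]
  obtain ⟨u, hu0, hu, hmax⟩ := exists_maximal_hasDerivWithinAt (g := f ∘ π)
    (hf.comp_continuous hπc hπ) (fun q => hM _ (hπ q)) hx y₀
  have hmem {k : ℝ → ℝ} (hk : ∀ x ∈ Icc x₀ (x₀ + h), |k x - y₀| ≤ b) {x : ℝ}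
      (hx : x ∈ Icc x₀ (x₀ + h)) :
      (x, k x) ∈ Icc x₀ (x₀ + h) ×ˢ Icc (y₀ - b) (y₀ + b) := by
    have := abs_le.1 (hk x hx)
    exact ⟨hx, by constructor <;> linarith⟩
  have hu_box := abs_sub_le_of_isSolOn hM0 hb hMh (fun q _ => hM _ (hπ q)) hu0
    fun x hx => ⟨mem_univ _, hu x hx⟩
  refine ⟨u, hu0, fun x hx => ⟨hmem hu_box hx, ?_⟩, fun v hv0 hv => hmax v hv0 fun x hx => ?_⟩
  · simpa [hπ_eq (hmem hu_box hx)] using hu x hx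
  · have hv_box := abs_sub_le_of_isSolOn hM0 hb hMh hM hv0 hv
    simpa [hπ_eq (hmem hv_box hx)] using (hv x hx).2

/-- Reflecting the independent variable turns a solution into a solution of the reflected
equation. -/
lemma IsSolOn.comp_neg {f : ℝ × ℝ → ℝ} {S : Set (ℝ × ℝ)} {φ : ℝ → ℝ} {I : Set ℝ}
    (hφ : IsSolOn f S φ I) :
    IsSolOn (fun q => -f (-q.1, q.2)) {q | (-q.1, q.2) ∈ S} (fun x => φ (-x)) (-I) := by
  intro x hx
  refine ⟨(hφ (-x) hx).1, ?_⟩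
  have hd := (hφ (-x) hx).2.scomp (s := -I) x (hasDerivAt_neg x).hasDerivWithinAt fun _ hy => hy
  simpa only [neg_one_smul] using! hd

/-- Reflecting the dependent variable turns a solution into a solution of the reflected
equation. -/
lemma IsSolOn.neg {f : ℝ × ℝ → ℝ} {S : Set (ℝ × ℝ)} {φ : ℝ → ℝ} {I : Set ℝ}
    (hφ : IsSolOn f S φ I) :
    IsSolOn (fun q => -f (q.1, -q.2)) {q | (q.1, -q.2) ∈ S} (fun x => -φ x) I := by
  intro x hx
  refine ⟨by simpa using (hφ x hx).1, ?_⟩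
  simpa only [neg_neg] using! (hφ x hx).2.neg

lemma IsSolOn.mono {f : ℝ × ℝ → ℝ} {S T : Set (ℝ × ℝ)} {φ : ℝ → ℝ} {I J : Set ℝ}
    (hφ : IsSolOn f S φ I) (hST : S ⊆ T) (hJI : J ⊆ I) : IsSolOn f T φ J :=
  fun x hx => ⟨hST (hφ x (hJI hx)).1, (hφ x (hJI hx)).2.mono hJI⟩

lemma IsSolOn.congr {f : ℝ × ℝ → ℝ} {S : Set (ℝ × ℝ)} {φ ψ : ℝ → ℝ} {I : Set ℝ}
    (hφ : IsSolOn f S φ I) (h : EqOn ψ φ I) : IsSolOn f S ψ I := by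
  intro x hx
  rw [h hx]
  exact ⟨(hφ x hx).1, (hφ x hx).2.congr h (h hx)⟩

/-- Solutions on two adjacent intervals glue together. -/
lemma IsSolOn.union_Icc {f : ℝ × ℝ → ℝ} {S : Set (ℝ × ℝ)} {φ : ℝ → ℝ} {α β γ : ℝ}
    (hαβ : α ≤ β) (hβγ : β ≤ γ) (h₁ : IsSolOn f S φ (Icc α β)) (h₂ : IsSolOn f S φ (Icc β γ)) :
    IsSolOn f S φ (Icc α γ) := by
  intro x hx
  rcases lt_trichotomy x β with hlt | rfl | hlt
  · obtain ⟨hS, hd⟩ := h₁ x ⟨hx.1, hlt.le⟩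
    refine ⟨hS, hd.mono_of_mem_nhdsWithin ?_⟩
    filter_upwards [self_mem_nhdsWithin, mem_nhdsWithin_of_mem_nhds (Iio_mem_nhds hlt)]
      with y hy hyβ using ⟨hy.1, le_of_lt hyβ⟩
  · rw [← Icc_union_Icc_eq_Icc hαβ hβγ]
    obtain ⟨hS, hd⟩ := h₁ x ⟨hx.1, le_rfl⟩
    exact ⟨hS, hd.union (h₂ x ⟨le_rfl, hx.2⟩).2⟩
  · obtain ⟨hS, hd⟩ := h₂ x ⟨hlt.le, hx.2⟩
    refine ⟨hS, hd.mono_of_mem_nhdsWithin ?_⟩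
    filter_upwards [self_mem_nhdsWithin, mem_nhdsWithin_of_mem_nhds (Ioi_mem_nhds hlt)]
      with y hy hyβ using ⟨le_of_lt hyβ, hy.2⟩

/-- Existence of the upper solution on a segment centred at the initial point. -/
lemma exists_upper_solution {f : ℝ × ℝ → ℝ} {x₀ y₀ h b M : ℝ}
    (hM0 : 0 ≤ M) (hb : 0 < b) (hh : 0 ≤ h) (hMh : M * h ≤ b)
    (hf : ContinuousOn f (Icc (x₀ - h) (x₀ + h) ×ˢ Icc (y₀ - b) (y₀ + b)))
    (hM : ∀ q ∈ Icc (x₀ - h) (x₀ + h) ×ˢ Icc (y₀ - b) (y₀ + b), |f q| ≤ M) :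
    ∃ u : ℝ → ℝ, u x₀ = y₀ ∧
      IsSolOn f (Icc (x₀ - h) (x₀ + h) ×ˢ Icc (y₀ - b) (y₀ + b)) u (Icc (x₀ - h) (x₀ + h)) ∧
      ∀ v : ℝ → ℝ, v x₀ = y₀ → IsSolOn f univ v (Icc (x₀ - h) (x₀ + h)) →
        ∀ x ∈ Icc (x₀ - h) (x₀ + h), v x ≤ u x := by
  have hleft : x₀ - h ≤ x₀ := by linarith
  have hright : x₀ ≤ x₀ + h := by linarith
  have hsub_right : Icc x₀ (x₀ + h) ⊆ Icc (x₀ - h) (x₀ + h) := Icc_subset_Icc_left hleft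
  have hsub_left : Icc (x₀ - h) x₀ ⊆ Icc (x₀ - h) (x₀ + h) := Icc_subset_Icc_right hright
  have hbox_right := prod_mono_left (t := Icc (y₀ - b) (y₀ + b)) hsub_right
  have hneg : -Icc (-x₀) (-x₀ + h) = Icc (x₀ - h) x₀ := by
    rw [neg_Icc]; congr 1 <;> ring
  have hneg' : -Icc (x₀ - h) x₀ = Icc (-x₀) (-x₀ + h) := by rw [← hneg, neg_neg]
  have hbox_left : MapsTo (fun q : ℝ × ℝ => (-q.1, q.2))
      (Icc (-x₀) (-x₀ + h) ×ˢ Icc (y₀ - b) (y₀ + b))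
      (Icc (x₀ - h) (x₀ + h) ×ˢ Icc (y₀ - b) (y₀ + b)) := fun q hq =>
    ⟨hsub_left (hneg ▸ neg_mem_neg.2 hq.1), hq.2⟩
  obtain ⟨r, hr0, hr, hr_max⟩ := exists_upper_solution_right hM0 hb hh hMh
    (hf.mono hbox_right) fun q hq => hM q (hbox_right hq)
  obtain ⟨l, hl0, hl, hl_max⟩ := exists_upper_solution_right (f := fun q => -f (-q.1, q.2))
    (x₀ := -x₀) (y₀ := y₀) hM0 hb hh hMh (hf.comp (by fun_prop) hbox_left).neg
    fun q hq => by simpa using hM _ (hbox_left hq)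
  have hl' : IsSolOn f (Icc (x₀ - h) (x₀ + h) ×ˢ Icc (y₀ - b) (y₀ + b)) (fun x => l (-x))
      (Icc (x₀ - h) x₀) := by
    have := hl.comp_neg
    simp only [neg_neg, hneg] at this
    refine this.mono (fun q hq => ?_) Subset.rfl
    simpa using hbox_left hq
  let u : ℝ → ℝ := fun x => if x ≤ x₀ then l (-x) else r x
  have hu_left : EqOn u (fun x => l (-x)) (Icc (x₀ - h) x₀) := fun x hx => if_pos hx.2
  have hu_right : EqOn u r (Icc x₀ (x₀ + h)) := fun x hx => by
    rcases hx.1.eq_or_lt with rfl | hlt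
    · simp [u, hl0, hr0]
    · exact if_neg hlt.not_ge
  refine ⟨u, by simp [u, hl0], (hl'.congr hu_left).union_Icc hleft hright
    ((hr.mono hbox_right Subset.rfl).congr hu_right), fun v hv0 hv x hx => ?_⟩
  rcases le_total x x₀ with hx' | hx'
  · rw [hu_left ⟨hx.1, hx'⟩]
    have hv' := (hv.mono Subset.rfl hsub_left).comp_neg
    rw [hneg'] at hv'
    have := hl_max (fun x => v (-x)) (by simpa using hv0) (hv'.mono (subset_univ _) Subset.rfl)
      (-x) (hneg' ▸ neg_mem_neg.2 ⟨hx.1, hx'⟩)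
    simpa using this
  · rw [hu_right ⟨hx', hx.2⟩]
    exact hr_max v hv0 (hv.mono Subset.rfl hsub_right) x ⟨hx', hx.2⟩

/-- Lemma on lower and upper solutions: there exist solutions `χˡ` and `χᵘ` of
IVP(x₀,y₀) on the Peano segment `[x₀ - h, x₀ + h]` bounding from below and from
above every solution of IVP(x₀,y₀) defined on that segment. -/
theorem lower_and_upper_solutions
    (G : Set (ℝ × ℝ)) (hG : IsOpen G) (f : ℝ × ℝ → ℝ) (hf : ContinuousOn f G)
    (x₀ y₀ a b : ℝ) (ha : 0 < a) (hb : 0 < b) (h₀ : (x₀, y₀) ∈ G)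
    (hR : Icc (x₀ - a) (x₀ + a) ×ˢ Icc (y₀ - b) (y₀ + b) ⊆ G)
    (M : ℝ)
    (hM : M = sSup ((fun p => |f p|) '' (Icc (x₀ - a) (x₀ + a) ×ˢ Icc (y₀ - b) (y₀ + b))))
    (h : ℝ) (hh : h = if M = 0 then a else min a (b / M)) :
    ∃ χl χu : ℝ → ℝ,
      χl x₀ = y₀ ∧ IsSolOn f G χl (Icc (x₀ - h) (x₀ + h)) ∧
      χu x₀ = y₀ ∧ IsSolOn f G χu (Icc (x₀ - h) (x₀ + h)) ∧
      ∀ χ : ℝ → ℝ, χ x₀ = y₀ → IsSolOn f G χ (Icc (x₀ - h) (x₀ + h)) →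
        ∀ x ∈ Icc (x₀ - h) (x₀ + h), χl x ≤ χ x ∧ χ x ≤ χu x := by
  have hboxc : IsCompact (Icc (x₀ - a) (x₀ + a) ×ˢ Icc (y₀ - b) (y₀ + b)) :=
    isCompact_Icc.prod isCompact_Icc
  have hM_le : ∀ q ∈ Icc (x₀ - a) (x₀ + a) ×ˢ Icc (y₀ - b) (y₀ + b), |f q| ≤ M := fun q hq =>
    hM ▸ le_csSup (hboxc.bddAbove_image (hf.mono hR).abs) (mem_image_of_mem _ hq)
  have hM0 : 0 ≤ M := (abs_nonneg _).trans
    (hM_le (x₀, y₀) ⟨by constructor <;> linarith, by constructor <;> linarith⟩)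
  obtain ⟨hh0, hha, hMh⟩ : 0 ≤ h ∧ h ≤ a ∧ M * h ≤ b := by
    split_ifs at hh with hM'
    · subst hh
      exact ⟨ha.le, le_rfl, by simp [hM', hb.le]⟩
    · have hpos : 0 < M := hM0.lt_of_ne' hM'
      subst hh
      refine ⟨le_min ha.le (by positivity), min_le_left _ _, ?_⟩
      calc M * min a (b / M) ≤ M * (b / M) := by gcongr; exact min_le_right _ _
        _ = b := mul_div_cancel₀ _ hM'
  have hsub : Icc (x₀ - h) (x₀ + h) ×ˢ Icc (y₀ - b) (y₀ + b) ⊆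
      Icc (x₀ - a) (x₀ + a) ×ˢ Icc (y₀ - b) (y₀ + b) :=
    prod_mono_left (Icc_subset_Icc (by linarith) (by linarith))
  have hneg : MapsTo (fun q : ℝ × ℝ => (q.1, -q.2))
      (Icc (x₀ - h) (x₀ + h) ×ˢ Icc (-y₀ - b) (-y₀ + b))
      (Icc (x₀ - h) (x₀ + h) ×ˢ Icc (y₀ - b) (y₀ + b)) := fun q hq =>
    ⟨hq.1, by linarith [hq.2.2], by linarith [hq.2.1]⟩
  have hfb := hf.mono (hsub.trans hR)
  obtain ⟨u, hu0, hu, hu_max⟩ := exists_upper_solution hM0 hb hh0 hMh hfb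
    fun q hq => hM_le q (hsub hq)
  obtain ⟨l, hl0, hl, hl_max⟩ := exists_upper_solution (f := fun q => -f (q.1, -q.2))
    (x₀ := x₀) (y₀ := -y₀) hM0 hb hh0 hMh (hfb.comp (by fun_prop) hneg).neg
    fun q hq => by simpa using hM_le _ (hsub (hneg hq))
  have hl' := hl.neg
  simp only [neg_neg] at hl'
  refine ⟨fun x => -l x, u, by simp [hl0], hl'.mono (fun q hq => ?_) Subset.rfl, hu0,
    hu.mono (hsub.trans hR) Subset.rfl, fun χ hχ0 hχ x hx => ⟨?_, ?_⟩⟩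
  · exact hR (hsub (by simpa using hneg hq))
  · exact neg_le.1 (hl_max (fun x => -χ x) (by simp [hχ0])
      (hχ.neg.mono (subset_univ _) Subset.rfl) x hx)
  · exact hu_max χ hχ0 (hχ.mono (subset_univ _) Subset.rfl) x hx
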